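/- Define sequences (a_i) and (b_i) of positive reals by a_1 = b_1 = 1, a_{i+1} = a_i/((i+3) b_i), and b_{i+1} = 4(1 + b_i/a_i). Then for every m ≥ 0, every subset A ⊆ V_m, and all distinct x, y ∈ A: if N is the length of a shortest path x = z_0 ∼_m z_1 ∼_m ⋯ ∼_m z_N = y in Γ_m whose interior vertices z_i (0 < i < N) all lie outside A (assuming at least one such path exists), then c^A_{x,y} ≥ a_N · (5/3)^m. -/

import Mathlib

open scoped BigOperators

noncomputable section

namespace SGPaper

/-- The three corners of the Sierpinski gasket:
`q₀ = (1/2, √3/2)`, `q₁ = (0,0)`, `q₂ = (1,0)`. -/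
def q : Fin 3 → ℝ × ℝ
  | 0 => (1 / 2, Real.sqrt 3 / 2)
  | 1 => (0, 0)
  | 2 => (1, 0)

/-- The contraction map towards corner `i`: `F_i(x) = (x + q_i)/2`. -/
def Fmap (i : Fin 3) (x : ℝ × ℝ) : ℝ × ℝ := (2⁻¹ : ℝ) • (x + q i)

/-- `Fword w = F_{w₁} ∘ ⋯ ∘ F_{w_m}` for the word `w = w₁⋯w_m`. -/
def Fword (w : List (Fin 3)) : ℝ × ℝ → ℝ × ℝ :=
  w.foldr (fun i f => Fmap i ∘ f) id

/-- The level-`m` vertex set of the Sierpinski gasket: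
`V_m = ⋃_{|w| = m} F_w({q₀, q₁, q₂})`. -/
def V (m : ℕ) : Set (ℝ × ℝ) :=
  {x | ∃ w : List (Fin 3), w.length = m ∧ ∃ i : Fin 3, x = Fword w (q i)}

/-- `x` and `y` are `m`-neighbors: they are distinct and belong to a common
level-`m` cell `F_w({q₀, q₁, q₂})`. -/
def Nbr (m : ℕ) (x y : ℝ × ℝ) : Prop :=
  x ≠ y ∧ ∃ w : List (Fin 3), w.length = m ∧
    (∃ i : Fin 3, x = Fword w (q i)) ∧ (∃ j : Fin 3, y = Fword w (q j))

/-- The value `(u x - u y)²` on the unordered pair `{x, y}`. -/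
def edgeVal (u : ℝ × ℝ → ℝ) : Sym2 (ℝ × ℝ) → ℝ :=
  Sym2.lift ⟨fun x y => (u x - u y) ^ 2, fun _ _ => by ring⟩

/-- The unordered pair `e` is an edge of the level-`m` graph `Γ_m`. -/
def IsEdge (m : ℕ) (e : Sym2 (ℝ × ℝ)) : Prop :=
  ∃ x y : ℝ × ℝ, Nbr m x y ∧ e = s(x, y)

/-- The level-`m` graph energy: `E_m(u) = (5/3)^m Σ (u x − u y)²`, the sum being over
unordered `m`-neighbor pairs `{x, y}` (a finite set, so `tsum` is the honest sum). -/
def Energy (m : ℕ) (u : ℝ × ℝ → ℝ) : ℝ :=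
  (5 / 3 : ℝ) ^ m * ∑' e : {e : Sym2 (ℝ × ℝ) // IsEdge m e}, edgeVal u e

/-- `Q_E(v)`: minimal level-`m` energy among functions `u : V_m → ℝ` agreeing
with `v` on `E` (the minimum is attained, so it equals this infimum). -/
def Q (m : ℕ) (E : Set (ℝ × ℝ)) (v : ℝ × ℝ → ℝ) : ℝ :=
  sInf {r | ∃ u : ℝ × ℝ → ℝ, (∀ x ∈ E, u x = v x) ∧ r = Energy m u}

/-- Indicator function of the point `z`. -/
def ind (z : ℝ × ℝ) : ℝ × ℝ → ℝ := fun t => if t = z then 1 else 0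

/-- The conductance `c^E_{x,y} = (Q_E(𝟙_x) + Q_E(𝟙_y) − Q_E(𝟙_x + 𝟙_y))/2`
between `x, y ∈ E`, computed at level `m`. -/
def cond (m : ℕ) (E : Set (ℝ × ℝ)) (x y : ℝ × ℝ) : ℝ :=
  (Q m E (ind x) + Q m E (ind y) - Q m E (ind x + ind y)) / 2

/-! helpers -/

/-- Barycentric coordinates with respect to the three corners. -/
def bary : Fin 3 → ℝ × ℝ → ℝ
  | 0 => fun p => 2 * p.2 / Real.sqrt 3
  | 1 => fun p => 1 - p.1 - p.2 / Real.sqrt 3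
  | 2 => fun p => p.1 - p.2 / Real.sqrt 3

lemma bary_q (k i : Fin 3) : bary k (q i) = if i = k then 1 else 0 := by
  have h3 : Real.sqrt 3 ≠ 0 := by positivity
  fin_cases k <;> fin_cases i <;> simp [bary, q] <;> field_simp <;> norm_num

lemma bary_Fmap (k j : Fin 3) (p : ℝ × ℝ) :
    bary k (Fmap j p) = (bary k p + if j = k then 1 else 0) / 2 := by
  rw [← bary_q]
  fin_cases k <;> simp [bary, Fmap] <;> ring

lemma Fword_cons (j : Fin 3) (w : List (Fin 3)) (p : ℝ × ℝ) :
    Fword (j :: w) p = Fmap j (Fword w p) := rfl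

lemma bary_bounds (w : List (Fin 3)) (i k : Fin 3) :
    0 ≤ bary k (Fword w (q i)) ∧ bary k (Fword w (q i)) ≤ 1 := by
  induction w with
  | nil =>
    change 0 ≤ bary k (q i) ∧ bary k (q i) ≤ 1
    rw [bary_q]; split_ifs <;> norm_num
  | cons j w ih =>
    rw [Fword_cons, bary_Fmap]
    split_ifs <;> constructor <;> linarith [ih.1, ih.2]

lemma bary_eq_one (w : List (Fin 3)) (i k : Fin 3)
    (h : 1 ≤ bary k (Fword w (q i))) : i = k := by
  induction w with
  | nil =>
    change 1 ≤ bary k (q i) at h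
    rw [bary_q] at h
    by_contra hne
    rw [if_neg hne] at h
    norm_num at h
  | cons j w ih =>
    rw [Fword_cons, bary_Fmap] at h
    apply ih
    split_ifs at h <;> linarith

lemma head_lemma (w w' : List (Fin 3)) (i i' k k' : Fin 3)
    (h : Fword (k :: w) (q i) = Fword (k' :: w') (q i')) (hk : k ≠ k') : i = k' := by
  apply bary_eq_one w
  have h1 := congrArg (bary k') h
  rw [Fword_cons, Fword_cons, bary_Fmap, bary_Fmap, if_neg hk, if_pos rfl] at h1
  linarith [(bary_bounds w' i' k').1]

lemma Fmap_inj (k : Fin 3) {p r : ℝ × ℝ} (h : Fmap k p = Fmap k r) : p = r := by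
  unfold Fmap at h
  have := smul_right_injective (ℝ × ℝ) (show (2⁻¹ : ℝ) ≠ 0 by norm_num) h
  exact add_right_cancel this

lemma heads_eq : ∀ k : Fin 3 → Fin 3, (∀ i j, k i ≠ k j → i = k j) → ∀ i, k i = k 0 := by
  decide

lemma not_all_corners (m : ℕ) : ∀ (x : ℝ × ℝ) (w : Fin 3 → List (Fin 3)),
    (∀ i, (w i).length = m) → (∀ i, x = Fword (w i) (q i)) → False := by
  induction m with
  | zero =>
    intro x w hw hx
    have h0 := hx 0
    have h1 := hx 1
    rw [List.length_eq_zero_iff.1 (hw 0)] at h0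
    rw [List.length_eq_zero_iff.1 (hw 1)] at h1
    have : q 0 = q 1 := h0.symm.trans h1
    have := congrArg (bary 0) this
    rw [bary_q, bary_q] at this
    norm_num at this
  | succ m ih =>
    intro x w hw hx
    have : ∀ i, ∃ k t, w i = k :: t := fun i => by
      have := hw i
      cases h : w i with
      | nil => rw [h] at this; simp at this
      | cons k t => exact ⟨k, t, rfl⟩
    choose k t hkt using this
    have hk := heads_eq k (fun i j hij => by
      apply head_lemma (t i) (t j) i j (k i) (k j) _ hij
      rw [← hkt, ← hkt, ← hx, ← hx])
    refine ih (Fword (t 0) (q 0)) t (fun i => ?_) (fun i => ?_)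
    · have := hw i
      rw [hkt i] at this
      simpa using this
    · apply Fmap_inj (k 0)
      have h0 := hx 0
      have h1 := hx i
      rw [hkt, Fword_cons] at h0 h1
      rw [hk i] at h1
      rw [← h0, ← h1]

lemma Fword_sub (w : List (Fin 3)) (p r : ℝ × ℝ) :
    Fword w p = Fword w r + ((2⁻¹ : ℝ) ^ w.length) • (p - r) := by
  induction w with
  | nil => simp [Fword]
  | cons j w ih =>
    rw [Fword_cons, Fword_cons, ih]
    simp only [Fmap, List.length_cons, pow_succ']
    module

lemma V_finite (m : ℕ) : (V m).Finite := by
  have h1 : {w : List (Fin 3) | w.length = m}.Finite := List.finite_length_eq (Fin 3) m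
  have h2 := (h1.prod (Set.finite_univ (α := Fin 3))).image (fun p => Fword p.1 (q p.2))
  refine h2.subset ?_
  rintro x ⟨w, hw, i, rfl⟩
  exact ⟨(w, i), ⟨hw, trivial⟩, rfl⟩

lemma Nbr.symm {m : ℕ} {x y : ℝ × ℝ} (h : Nbr m x y) : Nbr m y x := by
  obtain ⟨h1, w, hw, hi, hj⟩ := h
  exact ⟨h1.symm, w, hw, hj, hi⟩

lemma nbrs_finite (m : ℕ) (x : ℝ × ℝ) : {y | Nbr m x y}.Finite := by
  refine (V_finite m).subset ?_
  rintro y ⟨-, w, hw, -, hj⟩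
  exact ⟨w, hw, hj⟩

/-- The neighbours of a point. -/
def nbrs (m : ℕ) (x : ℝ × ℝ) : Finset (ℝ × ℝ) := (nbrs_finite m x).toFinset

lemma mem_nbrs {m : ℕ} {x y : ℝ × ℝ} : y ∈ nbrs m x ↔ Nbr m x y := by
  simp [nbrs]

lemma edges_finite (m : ℕ) : {e | IsEdge m e}.Finite := by
  refine (((V_finite m).prod (V_finite m)).image (fun p => s(p.1, p.2))).subset ?_
  rintro e ⟨x, y, ⟨-, w, hw, hi, hj⟩, rfl⟩
  exact ⟨(x, y), ⟨⟨w, hw, hi⟩, ⟨w, hw, hj⟩⟩, rfl⟩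

/-- The edges of the level `m` graph. -/
def edges (m : ℕ) : Finset (Sym2 (ℝ × ℝ)) := (edges_finite m).toFinset

lemma mem_edges {m : ℕ} {e : Sym2 (ℝ × ℝ)} : e ∈ edges m ↔ IsEdge m e := by
  simp [edges]

lemma card_pairs : ∀ i0 : Fin 3, (Finset.univ.filter
    (fun p : Fin 3 × Fin 3 => p.1 ≠ i0 ∧ p.1 ≠ p.2)).card = 4 := by
  decide

lemma card_nbrs (m : ℕ) (x : ℝ × ℝ) : (nbrs m x).card ≤ 4 := by
  classical
  have : ∃ i0 : Fin 3, ∀ w : List (Fin 3), w.length = m → x ≠ Fword w (q i0) := by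
    by_contra hcon
    push Not at hcon
    choose w hw hx using hcon
    exact not_all_corners m x w hw hx
  obtain ⟨i0, hi0⟩ := this
  rw [← card_pairs i0]
  refine le_trans (Finset.card_le_card ?_) (Finset.card_image_le
    (f := fun p : Fin 3 × Fin 3 => x + ((2⁻¹ : ℝ) ^ m) • (q p.2 - q p.1)))
  intro y hy
  obtain ⟨hne, w, hw, ⟨i, hi⟩, ⟨j, hj⟩⟩ := mem_nbrs.1 hy
  rw [Finset.mem_image]
  refine ⟨(i, j), ?_, ?_⟩
  · simp only [Finset.mem_filter, Finset.mem_univ, true_and]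
    constructor
    · rintro rfl
      exact hi0 w hw hi
    · rintro rfl
      exact hne (hi.trans hj.symm)
  · simp only
    rw [hj, hi, ← hw, ← Fword_sub]

/-- The bilinear version of `edgeVal`. -/
def edgeBil (u v : ℝ × ℝ → ℝ) : Sym2 (ℝ × ℝ) → ℝ :=
  Sym2.lift ⟨fun x y => (u x - u y) * (v x - v y), fun _ _ => by ring⟩

/-- The unnormalised energy. -/
def S (m : ℕ) (u : ℝ × ℝ → ℝ) : ℝ := ∑ e ∈ edges m, edgeVal u e

/-- The unnormalised bilinear energy. -/
def B (m : ℕ) (u v : ℝ × ℝ → ℝ) : ℝ := ∑ e ∈ edges m, edgeBil u v e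

lemma Energy_eq (m : ℕ) (u : ℝ × ℝ → ℝ) : Energy m u = (5 / 3 : ℝ) ^ m * S m u := by
  unfold Energy S
  congr 1
  have h := Finset.tsum_subtype (edges m) (edgeVal u)
  rw [← h]
  exact Equiv.tsum_eq (Equiv.subtypeEquivRight (fun e => mem_edges.symm))
    (fun e : {e // e ∈ edges m} => edgeVal u e)

lemma S_nonneg (m : ℕ) (u : ℝ × ℝ → ℝ) : 0 ≤ S m u := by
  refine Finset.sum_nonneg (fun e _ => ?_)
  induction e with
  | _ x y => exact sq_nonneg (u x - u y)

lemma S_add_smul (m : ℕ) (u v : ℝ × ℝ → ℝ) (t : ℝ) :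
    S m (u + t • v) = S m u + 2 * t * B m v u + t ^ 2 * S m v := by
  unfold S B
  rw [Finset.mul_sum, Finset.mul_sum, ← Finset.sum_add_distrib, ← Finset.sum_add_distrib]
  refine Finset.sum_congr rfl (fun e _ => ?_)
  induction e with
  | _ x y =>
    simp only [edgeVal, edgeBil, Sym2.lift_mk, Pi.add_apply, Pi.smul_apply, smul_eq_mul]
    ring

lemma B_sub_left (m : ℕ) (u v h : ℝ × ℝ → ℝ) : B m (u - v) h = B m u h - B m v h := by
  unfold B
  rw [← Finset.sum_sub_distrib]
  refine Finset.sum_congr rfl (fun e _ => ?_)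
  induction e with
  | _ x y =>
    simp only [edgeBil, Sym2.lift_mk, Pi.sub_apply]
    ring

lemma B_ind (m : ℕ) (p : ℝ × ℝ) (h : ℝ × ℝ → ℝ) :
    B m (ind p) h = ∑ z ∈ nbrs m p, (h p - h z) := by
  classical
  unfold B
  have hinj : Set.InjOn (fun z => s(p, z)) (nbrs m p : Set (ℝ × ℝ)) := by
    intro a _ b _ hab
    exact Sym2.congr_right.1 hab
  have h1 : ∑ z ∈ nbrs m p, (h p - h z)
      = ∑ e ∈ (nbrs m p).image (fun z => s(p, z)), edgeBil (ind p) h e := by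
    rw [Finset.sum_image hinj]
    refine Finset.sum_congr rfl (fun z hz => ?_)
    have hne : z ≠ p := (mem_nbrs.1 hz).1.symm
    simp [edgeBil, ind, hne]
  rw [h1]
  symm
  apply Finset.sum_subset
  · intro e he
    obtain ⟨z, hz, rfl⟩ := Finset.mem_image.1 he
    exact mem_edges.2 ⟨p, z, mem_nbrs.1 hz, rfl⟩
  · intro e he hne
    obtain ⟨a, b, hab, rfl⟩ := mem_edges.1 he
    have ha : a ≠ p := by
      rintro rfl
      exact hne (Finset.mem_image.2 ⟨b, mem_nbrs.2 hab, rfl⟩)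
    have hb : b ≠ p := by
      rintro rfl
      exact hne (Finset.mem_image.2 ⟨a, mem_nbrs.2 hab.symm, Sym2.eq_swap⟩)
    simp [edgeBil, ind, ha, hb]

lemma S_continuous (m : ℕ) : Continuous (S m) := by
  unfold S
  refine continuous_finsetSum _ (fun e _ => ?_)
  induction e with
  | _ x y =>
    simp only [edgeVal, Sym2.lift_mk]
    fun_prop

/-- Truncation to `[0,1]`. -/
def clamp (t : ℝ) : ℝ := max 0 (min t 1)

lemma clamp_sq (s t : ℝ) : (clamp s - clamp t) ^ 2 ≤ (s - t) ^ 2 := by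
  apply sq_le_sq.2
  unfold clamp
  rw [max_comm 0, max_comm 0]
  refine (abs_max_sub_max_le_abs _ _ _).trans ((abs_min_sub_min_le_max s 1 t 1).trans ?_)
  simp

lemma S_clamp (m : ℕ) (u : ℝ × ℝ → ℝ) : S m (fun p => clamp (u p)) ≤ S m u := by
  refine Finset.sum_le_sum (fun e _ => ?_)
  induction e with
  | _ x y => exact clamp_sq (u x) (u y)

lemma exists_min (m : ℕ) (A : Set (ℝ × ℝ)) (x : ℝ × ℝ) :
    ∃ h : ℝ × ℝ → ℝ, (∀ p ∈ A, h p = ind x p) ∧ (∀ p, 0 ≤ h p) ∧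
      ∀ u : ℝ × ℝ → ℝ, (∀ p ∈ A, u p = ind x p) → S m h ≤ S m u := by
  let K : Set (ℝ × ℝ → ℝ) := Set.pi Set.univ (fun _ => Set.Icc (0 : ℝ) 1) ∩
    {u | ∀ p ∈ A, u p = ind x p}
  have hK : IsCompact K := by
    refine (isCompact_univ_pi (fun _ => isCompact_Icc)).inter_right ?_
    simp only [Set.ofPred_forall]
    refine isClosed_iInter (fun p => isClosed_iInter (fun _ => ?_))
    exact isClosed_eq (continuous_apply p) continuous_const
  have hne : K.Nonempty := by
    refine ⟨ind x, ?_, fun p _ => rfl⟩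
    intro p _
    simp only [ind]
    split_ifs <;> simp
  obtain ⟨h, hh, hmin⟩ := hK.exists_isMinOn hne (S_continuous m).continuousOn
  refine ⟨h, hh.2, fun p => (hh.1 p trivial).1, fun u hu => ?_⟩
  refine le_trans (hmin ?_) (S_clamp m u)
  refine ⟨fun p _ => ⟨le_max_left _ _, ?_⟩, fun p hp => ?_⟩
  · exact max_le zero_le_one (min_le_right _ _)
  · simp only [hu p hp, ind, clamp]
    split_ifs <;> simp

lemma B_eq_zero {m : ℕ} {A : Set (ℝ × ℝ)} {v h g : ℝ × ℝ → ℝ}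
    (hA : ∀ p ∈ A, h p = v p)
    (hmin : ∀ u : ℝ × ℝ → ℝ, (∀ p ∈ A, u p = v p) → S m h ≤ S m u)
    (hg : ∀ p ∈ A, g p = 0) : B m g h = 0 := by
  have key : ∀ t : ℝ, 0 ≤ 2 * t * B m g h + t ^ 2 * S m g := fun t => by
    have := hmin (h + t • g) (fun p hp => by simp [hA p hp, hg p hp])
    rw [S_add_smul] at this
    linarith
  have hS := S_nonneg m g
  have h1 := key (-(B m g h) / (S m g + 1))
  have hpos : 0 < S m g + 1 := by linarith
  have h2 : 2 * (-(B m g h) / (S m g + 1)) * B m g h + (-(B m g h) / (S m g + 1)) ^ 2 * S m g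
      = -((B m g h) ^ 2 * (S m g + 2) / (S m g + 1) ^ 2) := by
    field_simp
    ring
  rw [h2] at h1
  by_contra hne
  have : 0 < (B m g h) ^ 2 * (S m g + 2) / (S m g + 1) ^ 2 := by positivity
  linarith

lemma Q_eq {m : ℕ} {A : Set (ℝ × ℝ)} {v h : ℝ × ℝ → ℝ}
    (hA : ∀ p ∈ A, h p = v p)
    (hmin : ∀ u : ℝ × ℝ → ℝ, (∀ p ∈ A, u p = v p) → S m h ≤ S m u) :
    Q m A v = (5 / 3 : ℝ) ^ m * S m h := by
  refine IsLeast.csInf_eq ⟨⟨h, hA, (Energy_eq m h).symm⟩, ?_⟩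
  rintro r ⟨u, hu, rfl⟩
  rw [Energy_eq]
  exact mul_le_mul_of_nonneg_left (hmin u hu) (by positivity)

lemma Q_le {m : ℕ} {A : Set (ℝ × ℝ)} {v u : ℝ × ℝ → ℝ}
    (hA : ∀ p ∈ A, u p = v p) : Q m A v ≤ (5 / 3 : ℝ) ^ m * S m u := by
  refine csInf_le ⟨0, ?_⟩ ⟨u, hA, (Energy_eq m u).symm⟩
  rintro r ⟨u, hu, rfl⟩
  rw [Energy_eq]
  have := S_nonneg m u
  positivity

lemma seq_bound (a b : ℕ → ℝ) (ha1 : a 1 = 1) (hb1 : b 1 = 1)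
    (ha : ∀ i : ℕ, 1 ≤ i → a (i + 1) = a i / (((i : ℝ) + 3) * b i))
    (hb : ∀ i : ℕ, 1 ≤ i → b (i + 1) = 4 * (1 + b i / a i)) (n : ℕ) :
    0 < a (n + 1) ∧ 1 ≤ b (n + 1) ∧ a (n + 1) ≤ (1 / 4 : ℝ) ^ n := by
  induction n with
  | zero => simp [ha1, hb1]
  | succ n ih =>
    obtain ⟨h1, h2, h3⟩ := ih
    have hbp : 0 < b (n + 1) := by linarith
    rw [ha (n + 1) (by omega), hb (n + 1) (by omega)]
    push_cast
    refine ⟨by positivity, ?_, ?_⟩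
    · have : 0 < b (n + 1) / a (n + 1) := by positivity
      linarith
    · rw [div_le_iff₀ (by positivity)]
      have hn : (0 : ℝ) ≤ n := Nat.cast_nonneg n
      have h4 : (4 : ℝ) ≤ ((n : ℝ) + 1 + 3) * b (n + 1) := by nlinarith
      calc a (n + 1) ≤ (1 / 4 : ℝ) ^ n := h3
        _ = (1 / 4 : ℝ) ^ (n + 1) * 4 := by rw [pow_succ]; ring
        _ ≤ _ := mul_le_mul_of_nonneg_left h4 (by positivity)

/-- With `a₁ = b₁ = 1`, `a_{i+1} = a_i/((i+3)b_i)`, `b_{i+1} = 4(1 + b_i/a_i)`: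
for every `m`, every `A ⊆ V_m` and distinct `x, y ∈ A`, if `N` is the length of a shortest
path from `x` to `y` in `Γ_m` whose interior vertices avoid `A`, then
`c^A_{x,y} ≥ a_N · (5/3)^m`. -/
theorem stmt5 (a b : ℕ → ℝ) (ha1 : a 1 = 1) (hb1 : b 1 = 1)
    (ha : ∀ i : ℕ, 1 ≤ i → a (i + 1) = a i / (((i : ℝ) + 3) * b i))
    (hb : ∀ i : ℕ, 1 ≤ i → b (i + 1) = 4 * (1 + b i / a i))
    (m : ℕ) (A : Set (ℝ × ℝ)) (hA : A ⊆ V m)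
    (x y : ℝ × ℝ) (hx : x ∈ A) (hy : y ∈ A) (hxy : x ≠ y)
    (N : ℕ) (z : ℕ → ℝ × ℝ) (hz0 : z 0 = x) (hzN : z N = y)
    (hpath : ∀ i < N, Nbr m (z i) (z (i + 1)))
    (hint : ∀ i, 0 < i → i < N → z i ∉ A)
    (hshort : ∀ (k : ℕ) (w : ℕ → ℝ × ℝ), w 0 = x → w k = y →
      (∀ i < k, Nbr m (w i) (w (i + 1))) → (∀ i, 0 < i → i < k → w i ∉ A) → N ≤ k) :
    a N * (5 / 3 : ℝ) ^ m ≤ cond m A x y := by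
  obtain ⟨n, rfl⟩ : ∃ n, N = n + 1 := by
    cases N with
    | zero => exact absurd (hz0.symm.trans hzN) hxy
    | succ n => exact ⟨n, rfl⟩
  obtain ⟨f, hfA, -, hfmin⟩ := exists_min m A x
  obtain ⟨h, hhA, hh0, hhmin⟩ := exists_min m A y
  have hsum : Q m A (ind x + ind y) ≤ (5 / 3 : ℝ) ^ m * S m (h + (1 : ℝ) • f) := by
    apply Q_le
    intro p hp
    simp [hfA p hp, hhA p hp, add_comm]
  have hB : B m f h = B m (ind x) h := by
    have h0 : B m (f - ind x) h = 0 :=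
      B_eq_zero hhA hhmin (fun p hp => by simp [hfA p hp])
    rw [B_sub_left] at h0
    linarith
  have hhx : h x = 0 := by rw [hhA x hx]; simp [ind, hxy]
  have hhy : h y = 1 := by rw [hhA y hy]; simp [ind]
  have hstep : ∀ k, k ≤ n → (1 / 4 : ℝ) ^ k ≤ h (z (n + 1 - k)) := by
    intro k
    induction k with
    | zero => intro _; simp [hzN, hhy]
    | succ k ih =>
      intro hk
      have ih := ih (by omega)
      have hpA := hint (n + 1 - (k + 1)) (by omega) (by omega)
      have hnb := hpath (n + 1 - (k + 1)) (by omega)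
      rw [show n + 1 - (k + 1) + 1 = n + 1 - k by omega] at hnb
      set p := z (n + 1 - (k + 1)) with hp
      have h0 : B m (ind p) h = 0 := B_eq_zero hhA hhmin (fun r hr => by
        have : r ≠ p := by rintro rfl; exact hpA hr
        simp [ind, this])
      rw [B_ind, Finset.sum_sub_distrib, Finset.sum_const, nsmul_eq_mul] at h0
      have h1 : h (z (n + 1 - k)) ≤ ∑ r ∈ nbrs m p, h r :=
        Finset.single_le_sum (fun r _ => hh0 r) (mem_nbrs.2 hnb)
      have h2 : ((nbrs m p).card : ℝ) ≤ 4 := by exact_mod_cast card_nbrs m p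
      have h3 := mul_le_mul_of_nonneg_right h2 (hh0 p)
      rw [pow_succ]
      linarith
  have hlast := hstep n le_rfl
  rw [show n + 1 - n = 1 by omega] at hlast
  have hflux : (1 / 4 : ℝ) ^ n ≤ - B m f h := by
    rw [hB, B_ind, hhx]
    have hnb := hpath 0 (by omega)
    rw [hz0] at hnb
    have h1 : h (z 1) ≤ ∑ r ∈ nbrs m x, h r :=
      Finset.single_le_sum (fun r _ => hh0 r) (mem_nbrs.2 hnb)
    simp only [zero_sub, Finset.sum_neg_distrib, neg_neg]
    linarith
  have hseq := (seq_bound a b ha1 hb1 ha hb n).2.2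
  have hfin : a (n + 1) * (5 / 3 : ℝ) ^ m ≤ - B m f h * (5 / 3 : ℝ) ^ m :=
    mul_le_mul_of_nonneg_right (hseq.trans hflux) (by positivity)
  rw [S_add_smul] at hsum
  unfold cond
  rw [Q_eq hfA hfmin, Q_eq hhA hhmin]
  linarith

end SGPaper
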